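/- Let λ_1,…,λ_n be nonzero complex numbers satisfying the nonresonance condition λ^k ≠ λ_j for all k ∈ ℕ^n with |k| ≥ 2 and all j, and let ρ be the linear map on polynomial vector fields given by (ρ v)_j = λ_j^{−1} v_j(λ_1 x_1,…,λ_n x_n). Let W be any generating sequence of polynomial vector fields with W_s homogeneous of degree s+1 for every s ≥ 1. Then there exists a unique generating sequence X with X_s homogeneous of degree s+1 for every s such that the composed generating sequence of W and ρ∘X equals X, i.e. for every s ≥ 1: W_s + ρ(X_s) + Σ_{j=1}^{s−1} (j/s) · Ê^W_{s−j}(ρ(X_j)) = X_s. (This is the formal linearization of the n-dimensional Schröder–Siegel map: T_W ∘ T_{ρ∘X} = T_X, conjugating the map to its diagonal linear part.) -/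

import Mathlib

open Finset

/-- The Lie bracket of polynomial vector fields:
`⁅v,w⁆_j = ∑_l (v_l ∂w_j/∂x_l − w_l ∂v_j/∂x_l)`. -/
noncomputable def bracketVF {n : ℕ} (v w : Fin n → MvPolynomial (Fin n) ℂ) :
    Fin n → MvPolynomial (Fin n) ℂ :=
  fun j => ∑ l, (v l * MvPolynomial.pderiv l (w j) - w l * MvPolynomial.pderiv l (v j))

/-- `ad(w) v = ⁅w,v⁆` as a `ℂ`-linear endomorphism of the space of polynomial
vector fields. -/
noncomputable def adVF {n : ℕ} (w : Fin n → MvPolynomial (Fin n) ℂ) :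
    Module.End ℂ (Fin n → MvPolynomial (Fin n) ℂ) where
  toFun v := bracketVF w v
  map_add' v v' := funext fun j => by
    simp only [bracketVF, Pi.add_apply, map_add, mul_add, add_mul]
    rw [← Finset.sum_add_distrib]
    exact Finset.sum_congr rfl fun l _ => by ring
  map_smul' c v := funext fun j => by
    simp only [bracketVF, Pi.smul_apply, map_smul, RingHom.id_apply]
    rw [Finset.smul_sum]
    exact Finset.sum_congr rfl fun l _ => by
      rw [Derivation.map_smul, mul_smul_comm, smul_mul_assoc, smul_sub]

/-- The operators `Ê^W_s` of the Lie transform: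
`Ê_0 = 1`, `Ê_s = (1/s) ∑_{j=1}^{s} j • (L j ∘ Ê_{s-j})` (`L j = ad(W_j)`, `L 0` unused). -/
noncomputable def Eseq {V : Type*} [AddCommGroup V] [Module ℂ V]
    (L : ℕ → Module.End ℂ V) : ℕ → Module.End ℂ V
  | 0 => 1
  | s + 1 => ((s + 1 : ℂ))⁻¹ • ∑ j ∈ Finset.range (s + 1),
      ((j + 1 : ℂ)) • (L (j + 1) * Eseq L (s - j))
  termination_by s => s
  decreasing_by omega

/-- The operator `ρ` of the diagonal linear map:
`(ρ v)_j = λ_j⁻¹ · v_j(λ_1 x_1, …, λ_n x_n)`. -/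
noncomputable def Rmap {n : ℕ} (lam : Fin n → ℂ)
    (v : Fin n → MvPolynomial (Fin n) ℂ) : Fin n → MvPolynomial (Fin n) ℂ :=
  fun j => (lam j)⁻¹ •
    MvPolynomial.aeval (fun l => MvPolynomial.C (lam l) * MvPolynomial.X l) (v j)

open MvPolynomial in
/-- `ρ` multiplies the `k`-th coefficient of the `j`-th component by `λ_j⁻¹ λ^k`. -/
theorem coeff_Rmap {n : ℕ} (lam : Fin n → ℂ) (v : Fin n → MvPolynomial (Fin n) ℂ)
    (j : Fin n) (k : Fin n →₀ ℕ) :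
    coeff k (Rmap lam v j) = (lam j)⁻¹ * (∏ l, lam l ^ k l) * coeff k (v j) := by
  have key : ∀ p : MvPolynomial (Fin n) ℂ,
      coeff k (aeval (fun l => C (lam l) * X l : Fin n → MvPolynomial (Fin n) ℂ) p) =
        (∏ l, lam l ^ k l) * coeff k p := by
    intro p
    induction p using MvPolynomial.induction_on' with
    | monomial u a =>
      have hm : aeval (fun l => C (lam l) * X l : Fin n → MvPolynomial (Fin n) ℂ)
          (monomial u a) = monomial u ((∏ l, lam l ^ u l) * a) := by
        rw [aeval_monomial, Finsupp.prod_fintype _ _ (fun _ => pow_zero _)]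
        simp only [mul_pow, Finset.prod_mul_distrib, ← map_pow, ← map_prod]
        rw [monomial_eq, Finsupp.prod_fintype _ _ (fun _ => pow_zero _), algebraMap_eq,
          map_mul, map_prod]
        ring
      rw [hm, coeff_monomial, coeff_monomial]
      split_ifs with h
      · rw [h]
      · rw [mul_zero]
    | add p q hp hq => rw [map_add, coeff_add, coeff_add, hp, hq, mul_add]
  rw [Rmap, coeff_smul, key, smul_eq_mul, mul_assoc]

theorem isHomogeneous_Rmap {n d : ℕ} (lam : Fin n → ℂ) {v : Fin n → MvPolynomial (Fin n) ℂ}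
    (hv : ∀ j, (v j).IsHomogeneous d) (j : Fin n) : (Rmap lam v j).IsHomogeneous d := by
  intro k hk
  rw [coeff_Rmap] at hk
  exact hv j (right_ne_zero_of_mul hk)

theorem isHomogeneous_bracketVF {n d e : ℕ} {v w : Fin n → MvPolynomial (Fin n) ℂ}
    (hv : ∀ j, (v j).IsHomogeneous (d + 1)) (hw : ∀ j, (w j).IsHomogeneous (e + 1))
    (j : Fin n) : (bracketVF v w j).IsHomogeneous (d + e + 1) := by
  refine MvPolynomial.IsHomogeneous.sum _ _ _ fun l _ => ?_
  refine MvPolynomial.IsHomogeneous.sub ?_ ?_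
  · rw [show d + e + 1 = d + 1 + (e + 1 - 1) by omega]
    exact (hv l).mul (hw j).pderiv
  · rw [show d + e + 1 = e + 1 + (d + 1 - 1) by omega]
    exact (hw l).mul (hv j).pderiv

theorem isHomogeneous_smul {σ R : Type*} [CommSemiring R] {p : MvPolynomial σ R} {d : ℕ}
    (c : R) (hp : p.IsHomogeneous d) : (c • p).IsHomogeneous d :=
  (MvPolynomial.homogeneousSubmodule σ R d).smul_mem c hp

/-- If every `W_i` is homogeneous of degree `i + 1`, then `Ê^W_s` raises degrees by `s`. -/
theorem isHomogeneous_Eseq {n : ℕ} {W : ℕ → Fin n → MvPolynomial (Fin n) ℂ}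
    (hW : ∀ s : ℕ, 1 ≤ s → ∀ j, (W s j).IsHomogeneous (s + 1)) (s : ℕ) {d : ℕ}
    {v : Fin n → MvPolynomial (Fin n) ℂ} (hv : ∀ j, (v j).IsHomogeneous (d + 1)) (j : Fin n) :
    (Eseq (fun i => adVF (W i)) s v j).IsHomogeneous (s + d + 1) := by
  induction s using Nat.strong_induction_on generalizing j with
  | _ s ih =>
    cases s with
    | zero =>
      rw [Eseq, zero_add]
      exact hv j
    | succ s =>
      rw [Eseq, LinearMap.smul_apply, LinearMap.sum_apply, Pi.smul_apply, Finset.sum_apply]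
      refine isHomogeneous_smul _ (MvPolynomial.IsHomogeneous.sum _ _ _ fun i hi => ?_)
      rw [LinearMap.smul_apply, Pi.smul_apply]
      refine isHomogeneous_smul _ ?_
      have hi' := Finset.mem_range.1 hi
      have h := isHomogeneous_bracketVF (hW (i + 1) (by omega)) (ih (s - i) (by omega)) j
      rwa [show i + 1 + (s - i + d) + 1 = s + 1 + d + 1 by omega] at h

/-- The solution `v` of the cohomological equation `b + ρ v = v`, obtained by dividing the
coefficients of `b` by the small divisors `1 - λ_j⁻¹ λ^k`. -/
noncomputable def cohomologicalSolution {n : ℕ} (lam : Fin n → ℂ)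
    (b : Fin n → MvPolynomial (Fin n) ℂ) : Fin n → MvPolynomial (Fin n) ℂ :=
  fun j => ∑ k ∈ (b j).support,
    MvPolynomial.monomial k ((b j).coeff k / (1 - (lam j)⁻¹ * ∏ l, lam l ^ k l))

theorem coeff_cohomologicalSolution {n : ℕ} (lam : Fin n → ℂ)
    (b : Fin n → MvPolynomial (Fin n) ℂ) (j : Fin n) (k : Fin n →₀ ℕ) :
    (cohomologicalSolution lam b j).coeff k =
      (b j).coeff k / (1 - (lam j)⁻¹ * ∏ l, lam l ^ k l) := by
  simp only [cohomologicalSolution, MvPolynomial.coeff_sum, MvPolynomial.coeff_monomial,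
    Finset.sum_ite_eq', MvPolynomial.mem_support_iff]
  split_ifs with h
  · rfl
  · rw [not_not.1 h, zero_div]

theorem isHomogeneous_cohomologicalSolution {n d : ℕ} (lam : Fin n → ℂ)
    {b : Fin n → MvPolynomial (Fin n) ℂ} (hb : ∀ j, (b j).IsHomogeneous d) (j : Fin n) :
    (cohomologicalSolution lam b j).IsHomogeneous d := by
  intro k hk
  rw [coeff_cohomologicalSolution] at hk
  exact hb j fun h => hk (by rw [h, zero_div])

/-- Under the nonresonance condition, the cohomological equation `b + ρ v = v` has exactly one
solution among vector fields of a given degree at least two. -/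
theorem add_Rmap_eq_iff {n d : ℕ} (hd : 2 ≤ d) {lam : Fin n → ℂ} (hlam : ∀ j, lam j ≠ 0)
    (hnr : ∀ k : Fin n →₀ ℕ, 2 ≤ ∑ l, k l → ∀ j : Fin n, (∏ l, lam l ^ k l) ≠ lam j)
    {b v : Fin n → MvPolynomial (Fin n) ℂ} (hb : ∀ j, (b j).IsHomogeneous d)
    (hv : ∀ j, (v j).IsHomogeneous d) :
    b + Rmap lam v = v ↔ v = cohomologicalSolution lam b := by
  simp only [funext_iff, MvPolynomial.ext_iff, Pi.add_apply, MvPolynomial.coeff_add, coeff_Rmap,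
    coeff_cohomologicalSolution]
  refine forall_congr' fun j => forall_congr' fun k => ?_
  by_cases hk : k.degree = d
  · have hne : 1 - (lam j)⁻¹ * ∏ l, lam l ^ k l ≠ 0 := by
      intro h
      refine hnr k (by rw [← Finsupp.degree_eq_sum]; omega) j ?_
      have h1 : (lam j)⁻¹ * ∏ l, lam l ^ k l = 1 := (sub_eq_zero.1 h).symm
      exact ((inv_mul_eq_one₀ (hlam j)).1 h1).symm
    rw [eq_div_iff hne]
    constructor <;> intro h <;> linear_combination -h
  · rw [(hb j).coeff_eq_zero hk, (hv j).coeff_eq_zero hk]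
    simp

/-- The generating sequence `X` defined recursively by solving the composition equation
order by order. -/
noncomputable def linearizingSeq {n : ℕ} (lam : Fin n → ℂ)
    (W : ℕ → Fin n → MvPolynomial (Fin n) ℂ) (s : ℕ) : Fin n → MvPolynomial (Fin n) ℂ :=
  cohomologicalSolution lam (W s + ∑ j ∈ (Finset.Icc 1 (s - 1)).attach,
    ((j.1 : ℂ) / (s : ℂ)) •
      Eseq (fun i => adVF (W i)) (s - j.1) (Rmap lam (linearizingSeq lam W j.1)))
  termination_by s
  decreasing_by
    have := Finset.mem_Icc.1 j.2
    omega

theorem linearizingSeq_eq {n : ℕ} (lam : Fin n → ℂ)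
    (W : ℕ → Fin n → MvPolynomial (Fin n) ℂ) (s : ℕ) :
    linearizingSeq lam W s = cohomologicalSolution lam (W s + ∑ j ∈ Finset.Icc 1 (s - 1),
      ((j : ℂ) / (s : ℂ)) •
        Eseq (fun i => adVF (W i)) (s - j) (Rmap lam (linearizingSeq lam W j))) := by
  rw [linearizingSeq, Finset.sum_attach (Finset.Icc 1 (s - 1)) fun j => ((j : ℂ) / (s : ℂ)) •
    Eseq (fun i => adVF (W i)) (s - j) (Rmap lam (linearizingSeq lam W j))]

/-- The part of the composition equation of order `s` that involves only `X_j` with `j < s`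
is homogeneous of degree `s + 1`. -/
theorem isHomogeneous_add_sum_Eseq {n : ℕ} (lam : Fin n → ℂ)
    {W X : ℕ → Fin n → MvPolynomial (Fin n) ℂ}
    (hW : ∀ s : ℕ, 1 ≤ s → ∀ j, (W s j).IsHomogeneous (s + 1)) {s : ℕ} (hs : 1 ≤ s)
    (hX : ∀ i : ℕ, 1 ≤ i → i < s → ∀ j, (X i j).IsHomogeneous (i + 1)) (j : Fin n) :
    ((W s + ∑ i ∈ Finset.Icc 1 (s - 1), ((i : ℂ) / (s : ℂ)) •
      Eseq (fun i => adVF (W i)) (s - i) (Rmap lam (X i))) j).IsHomogeneous (s + 1) := by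
  rw [Pi.add_apply, Finset.sum_apply]
  refine (hW s hs j).add (MvPolynomial.IsHomogeneous.sum _ _ _ fun i hi => ?_)
  have hi' := Finset.mem_Icc.1 hi
  have h := isHomogeneous_Eseq hW (s - i)
    (isHomogeneous_Rmap lam (hX i (by omega) (by omega))) j
  rw [show s - i + i + 1 = s + 1 by omega] at h
  exact isHomogeneous_smul _ h

theorem isHomogeneous_linearizingSeq {n : ℕ} (lam : Fin n → ℂ)
    {W : ℕ → Fin n → MvPolynomial (Fin n) ℂ}
    (hW : ∀ s : ℕ, 1 ≤ s → ∀ j, (W s j).IsHomogeneous (s + 1)) (s : ℕ) (hs : 1 ≤ s)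
    (j : Fin n) : (linearizingSeq lam W s j).IsHomogeneous (s + 1) := by
  induction s using Nat.strong_induction_on generalizing j with
  | _ s ih =>
    rw [linearizingSeq_eq]
    exact isHomogeneous_cohomologicalSolution lam
      (isHomogeneous_add_sum_Eseq lam hW hs fun i hi his j => ih i his hi j) j

/-- formal linearization of the `n`-dimensional Schröder–Siegel
map.  Under the nonresonance condition `λ^k ≠ λ_j` for `|k| ≥ 2`, for every
generating sequence `W` with `W_s` homogeneous of degree `s+1` there is a
generating sequence `X`, unique for `s ≥ 1`, with `X_s` homogeneous of degree
`s+1` such that `W_s + ρ(X_s) + ∑_{j=1}^{s−1} (j/s) • Ê^W_{s−j}(ρ(X_j)) = X_s`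
for every `s ≥ 1` (i.e. the composed generating sequence of `W` and `ρ∘X`
equals `X`: `T_W ∘ T_{ρ∘X} = T_X`). -/
theorem schroeder_siegel_linearization {n : ℕ} (lam : Fin n → ℂ)
    (hlam : ∀ j, lam j ≠ 0)
    (hnr : ∀ k : Fin n →₀ ℕ, 2 ≤ ∑ l, k l → ∀ j : Fin n,
      (∏ l, lam l ^ k l) ≠ lam j)
    (W : ℕ → Fin n → MvPolynomial (Fin n) ℂ)
    (hW : ∀ s : ℕ, 1 ≤ s → ∀ j, (W s j).IsHomogeneous (s + 1)) :
    ∃ X : ℕ → Fin n → MvPolynomial (Fin n) ℂ,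
      ((∀ s : ℕ, 1 ≤ s → ∀ j, (X s j).IsHomogeneous (s + 1)) ∧
        (∀ s : ℕ, 1 ≤ s →
          W s + Rmap lam (X s) +
            ∑ j ∈ Finset.Icc 1 (s - 1), ((j : ℂ) / (s : ℂ)) •
              Eseq (fun i => adVF (W i)) (s - j) (Rmap lam (X j)) = X s)) ∧
      (∀ X' : ℕ → Fin n → MvPolynomial (Fin n) ℂ,
        ((∀ s : ℕ, 1 ≤ s → ∀ j, (X' s j).IsHomogeneous (s + 1)) ∧
          (∀ s : ℕ, 1 ≤ s →
            W s + Rmap lam (X' s) +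
              ∑ j ∈ Finset.Icc 1 (s - 1), ((j : ℂ) / (s : ℂ)) •
                Eseq (fun i => adVF (W i)) (s - j) (Rmap lam (X' j)) = X' s)) →
          ∀ s : ℕ, 1 ≤ s → X' s = X s) := by
  have hX := isHomogeneous_linearizingSeq lam hW
  refine ⟨linearizingSeq lam W, ⟨hX, fun s hs => ?_⟩, fun X' ⟨hX', heq⟩ s hs => ?_⟩
  · rw [add_right_comm, add_Rmap_eq_iff (by omega) hlam hnr
      (isHomogeneous_add_sum_Eseq lam hW hs fun i hi _ => hX i hi) (hX s hs)]
    exact linearizingSeq_eq lam W s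
  · induction s using Nat.strong_induction_on with
    | _ s ih =>
      have h := heq s hs
      rw [add_right_comm, add_Rmap_eq_iff (by omega) hlam hnr
        (isHomogeneous_add_sum_Eseq lam hW hs fun i hi _ => hX' i hi) (hX' s hs)] at h
      have hsum : ∑ i ∈ Finset.Icc 1 (s - 1), ((i : ℂ) / (s : ℂ)) •
            Eseq (fun i => adVF (W i)) (s - i) (Rmap lam (X' i)) =
          ∑ i ∈ Finset.Icc 1 (s - 1), ((i : ℂ) / (s : ℂ)) •
            Eseq (fun i => adVF (W i)) (s - i) (Rmap lam (linearizingSeq lam W i)) :=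
        Finset.sum_congr rfl fun i hi => by
          have hi' := Finset.mem_Icc.1 hi
          rw [ih i (by omega) (by omega)]
      rw [h, linearizingSeq_eq, hsum]
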